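/- Let P ⊂ ℝ³ be a 3-dimensional one-point lattice simplex, i.e. a lattice simplex with the origin in its interior whose only lattice points are the origin and its four vertices. Then Vol(P) ≤ 20, with equality if and only if P is unimodularly equivalent to conv{(1,0,0), (0,1,0), (1,2,5), (−2,−3,−5)}. -/

import Mathlib

/-- The canonical embedding of integer vectors into real vectors. -/
def toR {d : ℕ} (x : Fin d → ℤ) : Fin d → ℝ := fun j => (x j : ℝ)

/-- The lattice simplex (as a subset of `ℝ^d`) with vertex family `v`. -/
def hullOf {d : ℕ} (v : Fin (d + 1) → Fin d → ℤ) : Set (Fin d → ℝ) :=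
  convexHull ℝ (Set.range fun i => toR (v i))

/-- `v` is the vertex family of a `d`-dimensional one-point lattice simplex:
the vertices are affinely independent lattice points, the origin lies in the
interior, and the only lattice points of the simplex are the origin and the
vertices. -/
def IsOnePointSimplex {d : ℕ} (v : Fin (d + 1) → Fin d → ℤ) : Prop :=
  AffineIndependent ℝ (fun i => toR (v i)) ∧
  (0 : Fin d → ℝ) ∈ interior (hullOf v) ∧
  ∀ x : Fin d → ℤ, toR x ∈ hullOf v → x = 0 ∨ ∃ i, x = v i

/-- Two subsets of `ℝ^d` are unimodularly equivalent if one is the image of the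
other under `x ↦ A x + w` with `A ∈ GL_d(ℤ)` and `w ∈ ℤ^d`. -/
def UnimodEquiv {d : ℕ} (Q Q' : Set (Fin d → ℝ)) : Prop :=
  ∃ (A : Matrix (Fin d) (Fin d) ℤ) (w : Fin d → ℤ), IsUnit A.det ∧
    Q' = (fun x => (A.map fun n : ℤ => (n : ℝ)).mulVec x + toR w) '' Q

/-- The residue group of a one-point simplex: `L` is a group of integer vectors containing
`V • ℤ⁴` whose coordinate sums are multiples of `V`, and `D` is its only vector with coordinates
in `[0, V)` and sum `V`. -/
structure IsResidueGroup (V : ℤ) (L : AddSubgroup (Fin 4 → ℤ)) (D : Fin 4 → ℤ) : Prop where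
  smul_mem : ∀ s : Fin 4 → ℤ, V • s ∈ L
  dvd_sum : ∀ r ∈ L, V ∣ ∑ i, r i
  mem : D ∈ L
  pos : ∀ i, 0 < D i
  sum_eq : ∑ i, D i = V
  eq_of_sum_eq : ∀ r ∈ L, (∀ i, 0 ≤ r i) → (∀ i, r i < V) → ∑ i, r i = V → r = D

theorem Int.emod_add_neg_emod_of_not_dvd {V a : ℤ} (hV : 0 < V) (ha : ¬ V ∣ a) :
    a % V + -a % V = V := by
  have h1 := Int.emod_add_mul_ediv a V
  have h2 := Int.emod_add_mul_ediv (-a) V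
  have h3 := Int.emod_lt_of_pos a hV
  have h4 := Int.emod_lt_of_pos (-a) hV
  have h5 := Int.emod_nonneg (-a) hV.ne'
  have h6 := Int.emod_pos_of_not_dvd ha
  obtain h6 | h6 := h6
  · omega
  have h7 : a % V + -a % V = V * (-(a / V) - (-a / V)) := by linarith
  have h8 : 0 < -(a / V) - (-a / V) := by
    by_contra! h
    nlinarith
  have h9 : -(a / V) - (-a / V) < 2 := by
    by_contra! h
    nlinarith
  have h10 : -(a / V) - (-a / V) = 1 := by omega
  rw [h7, h10, mul_one]

namespace IsResidueGroup

variable {V : ℤ} {L : AddSubgroup (Fin 4 → ℤ)} {D : Fin 4 → ℤ}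

theorem V_pos (H : IsResidueGroup V L D) : 0 < V := by
  rw [← H.sum_eq]
  exact Finset.sum_pos (fun i _ => H.pos i) Finset.univ_nonempty

theorem emod_mem (H : IsResidueGroup V L D) {r : Fin 4 → ℤ} (hr : r ∈ L) :
    (fun i => r i % V) ∈ L := by
  have : (fun i => r i % V) = r - V • fun i => r i / V := by
    funext i
    simp [Int.emod_def]
  rw [this]
  exact L.sub_mem hr (H.smul_mem _)

theorem emod_eq (H : IsResidueGroup V L D) {r : Fin 4 → ℤ} (hr : r ∈ L)
    (hsum : ∑ i, r i % V = V) (i : Fin 4) : r i % V = D i :=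
  congrFun (H.eq_of_sum_eq _ (H.emod_mem hr) (fun _ => Int.emod_nonneg _ H.V_pos.ne')
    (fun _ => Int.emod_lt_of_pos _ H.V_pos) hsum) i

theorem dvd_sum_emod (H : IsResidueGroup V L D) {r : Fin 4 → ℤ} (hr : r ∈ L) :
    V ∣ ∑ i, r i % V := H.dvd_sum _ (H.emod_mem hr)

theorem dvd_of_dvd (H : IsResidueGroup V L D) {r : Fin 4 → ℤ} (hr : r ∈ L) {i : Fin 4}
    (hi : V ∣ r i) (j : Fin 4) : V ∣ r j := by
  by_contra hj
  have hV := H.V_pos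
  have hr' : -r ∈ L := L.neg_mem hr
  obtain ⟨x, hx⟩ := H.dvd_sum_emod hr
  obtain ⟨y, hy⟩ := H.dvd_sum_emod hr'
  have hsum : V * x + V * y ≤ 3 * V := by
    rw [← hx, ← hy, ← Finset.sum_add_distrib]
    calc ∑ l, (r l % V + (-r) l % V) ≤ ∑ l, if l = i then 0 else V := by
          refine Finset.sum_le_sum fun l _ => ?_
          split_ifs with h
          · subst h
            simp [Int.emod_eq_zero_of_dvd hi, Int.emod_eq_zero_of_dvd ((Int.dvd_neg).2 hi)]
          · by_cases hl : V ∣ r l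
            · simpa [Int.emod_eq_zero_of_dvd hl, Int.emod_eq_zero_of_dvd ((Int.dvd_neg).2 hl)]
                using hV.le
            · exact (Int.emod_add_neg_emod_of_not_dvd hV hl).le
      _ = 3 * V := by
          simp [Finset.sum_ite, Finset.filter_ne']
  have hpos : ∀ s : Fin 4 → ℤ, ¬ V ∣ s j → 0 < ∑ l, s l % V := fun s hs =>
    Finset.sum_pos' (fun l _ => Int.emod_nonneg _ hV.ne')
      ⟨j, Finset.mem_univ _, by
        have := Int.emod_nonneg (s j) hV.ne'
        have := mt Int.dvd_of_emod_eq_zero hs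
        omega⟩
  have hx0 := hpos r hj
  have hy0 := hpos (-r) (by simpa using hj)
  rw [hx] at hx0
  rw [hy] at hy0
  have hx1 : 0 < x := pos_of_mul_pos_right hx0 hV.le
  have hy1 : 0 < y := pos_of_mul_pos_right hy0 hV.le
  have hxy : x + y ≤ 3 := by
    by_contra! h
    nlinarith
  have hDi := H.pos i
  obtain h | h : x = 1 ∨ y = 1 := by omega
  · have := H.emod_eq hr (by rw [hx, h, mul_one]) i
    rw [Int.emod_eq_zero_of_dvd hi] at this
    omega
  · have := H.emod_eq hr' (by rw [hy, h, mul_one]) i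
    rw [Pi.neg_apply, Int.emod_eq_zero_of_dvd ((Int.dvd_neg).2 hi)] at this
    omega

theorem sum_emod (H : IsResidueGroup V L D) {r : Fin 4 → ℤ} (hr : r ∈ L) (h0 : ¬ V ∣ r 0)
    (hD : ¬ V ∣ r 0 - D 0) (hD' : ¬ V ∣ r 0 + D 0) : ∑ i, r i % V = 2 * V := by
  have hV := H.V_pos
  have hr' : -r ∈ L := L.neg_mem hr
  have hnd : ∀ i, ¬ V ∣ r i := fun i hi => h0 (H.dvd_of_dvd hr hi 0)
  obtain ⟨x, hx⟩ := H.dvd_sum_emod hr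
  obtain ⟨y, hy⟩ := H.dvd_sum_emod hr'
  have hsum : V * x + V * y = 4 * V := by
    rw [← hx, ← hy, ← Finset.sum_add_distrib]
    simp [fun i => Int.emod_add_neg_emod_of_not_dvd hV (hnd i)]
  have hxy : x + y = 4 := by
    have : V * (x + y) = V * 4 := by linarith
    exact mul_left_cancel₀ hV.ne' this
  have hx1 : x ≠ 1 := fun h => hD <| by
    rw [← H.emod_eq hr (by rw [hx, h, mul_one]) 0]
    exact Int.dvd_self_sub_emod
  have hy1 : y ≠ 1 := fun h => hD' <| by
    rw [← H.emod_eq hr' (by rw [hy, h, mul_one]) 0]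
    exact ⟨-(-r 0 / V), by rw [Pi.neg_apply, Int.emod_def]; ring⟩
  have hpos : ∀ s : Fin 4 → ℤ, ¬ V ∣ s 0 → 0 < ∑ l, s l % V := fun s hs =>
    Finset.sum_pos' (fun l _ => Int.emod_nonneg _ hV.ne')
      ⟨0, Finset.mem_univ _, by
        have := Int.emod_nonneg (s 0) hV.ne'
        have := mt Int.dvd_of_emod_eq_zero hs
        omega⟩
  have hx2 : 0 < x := pos_of_mul_pos_right (hx ▸ hpos r h0) hV.le
  have hy2 : 0 < y := pos_of_mul_pos_right (hy ▸ hpos (-r) (by simpa using h0)) hV.le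
  have : x = 2 := by omega
  rw [hx, this, mul_comm]

theorem eq_zero_of_abs_lt (H : IsResidueGroup V L D) {m : ℤ} (hm : ∀ i, m ≤ D i)
    (hmV : 4 * m ≤ V) {s : Fin 4 → ℤ} (hs : s ∈ L) (hlt : ∀ i, |s i| < m) : s = 0 := by
  have hsum : ∑ i, s i = 0 := by
    refine Int.eq_zero_of_abs_lt_dvd (H.dvd_sum s hs) ?_
    have := fun i => abs_lt.1 (hlt i)
    have h0 := this 0
    have h1 := this 1
    have h2 := this 2
    have h3 := this 3
    rw [abs_lt, Fin.sum_univ_four]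
    constructor <;> linarith
  have hpos : ∀ i, 0 < s i + D i := fun i => by
    have := (abs_lt.1 (hlt i)).1
    have := hm i
    linarith
  have htot : ∑ i, (s + D) i = V := by
    simp [Finset.sum_add_distrib, hsum, H.sum_eq]
  have hltV : ∀ i, (s + D) i < V := fun i => by
    obtain ⟨j, hj⟩ := exists_ne i
    rw [← htot]
    exact Finset.single_lt_sum hj (Finset.mem_univ _) (Finset.mem_univ _) (hpos j)
      (fun k _ _ => (hpos k).le)
  have := H.eq_of_sum_eq _ (L.add_mem hs H.mem) (fun i => (hpos i).le) hltV htot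
  exact add_eq_right.1 this

theorem exists_generator (H : IsResidueGroup V L D) (B : Matrix (Fin 4) (Fin 4) ℤ)
    (hB : ∀ i, B i ∈ L) (hdet : B.det ∣ V ^ 3) :
    ∃ g ∈ L, g 0 = 1 ∧ ∀ r ∈ L, ∀ i, V ∣ r i - r 0 * g i := by
  obtain ⟨t, ht⟩ := Int.subgroup_cyclic (L.map (Pi.evalAddMonoidHom (fun _ : Fin 4 => ℤ) 0))
  have htmem : t ∈ L.map (Pi.evalAddMonoidHom (fun _ : Fin 4 => ℤ) 0) := by
    rw [ht]; exact AddSubgroup.mem_closure_singleton_self t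
  obtain ⟨u, hu, hut⟩ := AddSubgroup.mem_map.1 htmem
  have hut : u 0 = t := hut
  have hdecomp : ∀ r ∈ L, ∃ n : ℤ, r 0 = n * t ∧ ∀ i, V ∣ r i - n * u i := by
    intro r hr
    have : r 0 ∈ L.map (Pi.evalAddMonoidHom (fun _ : Fin 4 => ℤ) 0) :=
      AddSubgroup.mem_map.2 ⟨r, hr, rfl⟩
    rw [ht, AddSubgroup.mem_closure_singleton] at this
    obtain ⟨n, hn⟩ := this
    refine ⟨n, by simpa using hn.symm, fun i => ?_⟩
    refine H.dvd_of_dvd (L.sub_mem hr (L.zsmul_mem hu n)) (i := 0) ?_ i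
    simp only [Pi.sub_apply, Pi.smul_apply, hut, ← hn, sub_self, dvd_zero]
  choose n hn0 hn using fun i => hdecomp (B i) (hB i)
  choose q hq using hn
  have hfac : B = Matrix.of (fun i => ![n i, q i 1, q i 2, q i 3]) *
      !![t, u 1, u 2, u 3; 0, V, 0, 0; 0, 0, V, 0; 0, 0, 0, V] := by
    ext i j
    have h1 := hq i 1
    have h2 := hq i 2
    have h3 := hq i 3
    have h0 := hn0 i
    fin_cases j <;> simp [Matrix.mul_apply, Fin.sum_univ_four] <;> linarith
  have hdetT : (!![t, u 1, u 2, u 3; 0, V, 0, 0; 0, 0, V, 0; 0, 0, 0, V] :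
      Matrix (Fin 4) (Fin 4) ℤ).det = t * V ^ 3 := by
    rw [Matrix.det_of_isUpperTriangular]
    · simp [Fin.prod_univ_four]; ring
    · intro i j hij
      fin_cases i <;> fin_cases j <;> simp_all
  have htV : t * V ^ 3 ∣ V ^ 3 := by
    rw [hfac, Matrix.det_mul, hdetT] at hdet
    exact (Dvd.intro_left _ rfl).trans hdet
  have hV3 : V ^ 3 ≠ 0 := pow_ne_zero _ H.V_pos.ne'
  have ht1 : t * t = 1 := by
    have : IsUnit t := by
      obtain ⟨c, hc⟩ := htV
      refine IsUnit.of_mul_eq_one c ?_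
      refine mul_right_cancel₀ hV3 ?_
      linarith
    exact Int.isUnit_mul_self this
  refine ⟨t • u, L.zsmul_mem hu t, by simp [hut, ht1], fun r hr i => ?_⟩
  obtain ⟨k, hk, hk'⟩ := hdecomp r hr
  have : r i - r 0 * (t • u) i = r i - k * u i := by
    simp only [Pi.smul_apply, smul_eq_mul, hk]
    linear_combination (-k * u i) * ht1
  rw [this]
  exact hk' i

end IsResidueGroup

/-- Whether `j * w + n` modulo `h` lies in the top `w` residues. -/
def wraps (h w n j : ℕ) : Bool := Nat.ble h ((n + j * w) % h + w)

/-- Whether the progressions `n + j * w` and `n' + j * w'` never wrap at the same time. -/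
def wrapsDisjoint (h w w' n n' : ℕ) : Bool :=
  (List.range h).all fun j => !(wraps h w n j && wraps h w' n' j)

/-- All offsets for which the four progressions with steps `a, b, c, d` never wrap together. -/
def disjointOffsets (h a b c d : ℕ) : List (ℕ × ℕ × ℕ × ℕ) :=
  (List.range h).flatMap fun p =>
    ((List.range h).filter (wrapsDisjoint h a b p)).flatMap fun q =>
      ((List.range h).filter fun r =>
          wrapsDisjoint h a c p r && wrapsDisjoint h b c q r).flatMap fun r =>
        ((List.range h).filter fun s => wrapsDisjoint h a d p s &&
            wrapsDisjoint h b d q s && wrapsDisjoint h c d r s).map fun s => (p, q, r, s)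

/-- The floor condition on weights `a, b, c, d` with sum `h`, for multipliers `2 ≤ k ≤ h - 2`. -/
def floorCheck (h a b c d : ℕ) : Bool :=
  (List.range (h - 3)).all fun k =>
    Nat.beq ((k + 2) * a / h + (k + 2) * b / h + (k + 2) * c / h + (k + 2) * d / h) k

def smallWeightsCheck (h : ℕ) : Bool :=
  (List.range h).all fun a => (List.range (h - a)).all fun b => (List.range (h - a - b)).all fun c =>
    Nat.beq a 0 || !(Nat.ble a b && Nat.ble b c && Nat.ble c (h - a - b - c)) ||
      !(floorCheck h a b c (h - a - b - c)) ||
      Nat.ble (h + (disjointOffsets h a b c (h - a - b - c)).length) 35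

set_option maxRecDepth 100000 in
theorem smallWeightsCheck_eq_true :
    ((List.range 20).all fun h => Nat.ble h 3 || smallWeightsCheck h) = true := by
  decide +kernel

def residueSum (V a b c k : ℕ) : ℕ := k % V + k * a % V + k * b % V + k * c % V

def generatorCheck (V a b c : ℕ) : Bool :=
  !(Nat.beq (Nat.gcd a V) 1 && Nat.beq (Nat.gcd b V) 1 && Nat.beq (Nat.gcd c V) 1 &&
    Nat.beq ((List.range V).countP fun k => Nat.beq (residueSum V a b c k) V) 1) ||
  (Nat.beq V 20 && [(9, 13, 17), (9, 17, 13), (13, 9, 17), (13, 17, 9), (17, 9, 13),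
    (17, 13, 9)].contains (a, b, c))

set_option maxRecDepth 100000 in
theorem generatorCheck_eq_true :
    ((List.range 36).all fun V => Nat.ble V 19 || (List.range V).all fun a =>
      (List.range V).all fun b => generatorCheck V a b ((2 * V - 1 - a - b) % V)) = true := by
  decide +kernel

/-- Records `⌊k β⌋` together with a lower and a strict upper bound for `β`, scaled by `12252240`. -/
structure FloorBracket where
  floor : ℕ
  lower : ℕ
  upper : ℕ

def FloorBracket.hit (s : FloorBracket) (k : ℕ) : FloorBracket :=
  ⟨s.floor + 1, max s.lower ((s.floor + 1) * (12252240 / (k + 1))), s.upper⟩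

def FloorBracket.miss (s : FloorBracket) (k : ℕ) : FloorBracket :=
  ⟨s.floor, s.lower, min s.upper ((s.floor + 1) * (12252240 / (k + 1)))⟩

def FloorBracket.inconsistent (a b c d : FloorBracket) : Bool :=
  Nat.ble a.upper a.lower || Nat.ble b.upper b.lower || Nat.ble c.upper c.lower ||
  Nat.ble d.upper d.lower || Nat.ble 12252241 (a.lower + b.lower + c.lower + d.lower) ||
  Nat.ble (a.upper + b.upper + c.upper + d.upper) 12252240

def FloorBracket.refute : ℕ → ℕ → FloorBracket → FloorBracket → FloorBracket → FloorBracket → Bool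
  | 0, _, a, b, c, d => inconsistent a b c d
  | n + 1, k, a, b, c, d => inconsistent a b c d ||
    (refute n (k + 1) (a.hit k) (b.miss k) (c.miss k) (d.miss k) &&
     refute n (k + 1) (a.miss k) (b.hit k) (c.miss k) (d.miss k) &&
     refute n (k + 1) (a.miss k) (b.miss k) (c.hit k) (d.miss k) &&
     refute n (k + 1) (a.miss k) (b.miss k) (c.miss k) (d.hit k))

theorem FloorBracket.refute_eq_true :
    refute 16 2 ⟨0, 0, 6126120⟩ ⟨0, 0, 6126120⟩ ⟨0, 0, 6126120⟩ ⟨0, 0, 6126120⟩ = true := by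
  decide +kernel

/-- The bracket `s` is correct for `β = w / h` at time `k`. -/

def FloorBracket.Valid (h w k : ℕ) (s : FloorBracket) : Prop :=
  s.floor = k * w / h ∧ h * s.lower ≤ 12252240 * w ∧ 12252240 * w < h * s.upper

theorem FloorBracket.Valid.hit {h w k : ℕ} {s : FloorBracket} (hs : s.Valid h w k)
    (hk : k + 1 ∣ 12252240) (hw : (k + 1) * w / h = k * w / h + 1) :
    (s.hit k).Valid h w (k + 1) := by
  obtain ⟨h1, h2, h3⟩ := hs
  obtain ⟨e, he⟩ := hk
  have hdiv : 12252240 / (k + 1) = e := by rw [he]; exact Nat.mul_div_cancel_left _ (by omega)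
  refine ⟨by simp only [FloorBracket.hit]; omega, ?_, h3⟩
  simp only [FloorBracket.hit, hdiv]
  rcases max_choice s.lower ((s.floor + 1) * e) with h5 | h5 <;> rw [h5]
  · exact h2
  have h4 : h * ((k + 1) * w / h) ≤ (k + 1) * w := Nat.mul_div_le _ _
  rw [hw, ← h1] at h4
  calc h * ((s.floor + 1) * e) = h * (s.floor + 1) * e := by ring
    _ ≤ (k + 1) * w * e := Nat.mul_le_mul_right _ h4
    _ = 12252240 * w := by rw [he]; ring

theorem FloorBracket.Valid.miss {h w k : ℕ} {s : FloorBracket} (hs : s.Valid h w k) (hh : 0 < h)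
    (hk : k + 1 ∣ 12252240) (hw : (k + 1) * w / h = k * w / h) :
    (s.miss k).Valid h w (k + 1) := by
  obtain ⟨h1, h2, h3⟩ := hs
  obtain ⟨e, he⟩ := hk
  have hdiv : 12252240 / (k + 1) = e := by rw [he]; exact Nat.mul_div_cancel_left _ (by omega)
  refine ⟨by simp only [FloorBracket.miss]; omega, h2, ?_⟩
  simp only [FloorBracket.miss, hdiv]
  rcases min_choice s.upper ((s.floor + 1) * e) with h5 | h5 <;> rw [h5]
  · exact h3
  have h4 : (k + 1) * w < h * ((k + 1) * w / h + 1) := Nat.lt_mul_div_succ _ hh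
  rw [hw, ← h1] at h4
  have he0 : 0 < e := by
    rcases Nat.eq_zero_or_pos e with h0 | h0
    · simp [h0] at he
    · exact h0
  calc 12252240 * w = (k + 1) * w * e := by rw [he]; ring
    _ < h * (s.floor + 1) * e := Nat.mul_lt_mul_of_pos_right h4 he0
    _ = h * ((s.floor + 1) * e) := by ring

theorem FloorBracket.inconsistent_eq_false {h k w₀ w₁ w₂ w₃ : ℕ} {a b c d : FloorBracket}
    (hsum : w₀ + w₁ + w₂ + w₃ = h) (hh : 0 < h) (ha : a.Valid h w₀ k) (hb : b.Valid h w₁ k)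
    (hc : c.Valid h w₂ k) (hd : d.Valid h w₃ k) : inconsistent a b c d = false := by
  obtain ⟨-, a1, a2⟩ := ha
  obtain ⟨-, b1, b2⟩ := hb
  obtain ⟨-, c1, c2⟩ := hc
  obtain ⟨-, d1, d2⟩ := hd
  have key : ∀ x y : ℕ, h * x < h * y → ¬ y ≤ x := fun x y hxy => by
    have := Nat.lt_of_mul_lt_mul_left hxy
    omega
  rw [← Bool.not_eq_true]
  simp only [inconsistent, Bool.or_eq_true, Nat.ble_eq, not_or]
  refine ⟨⟨⟨⟨⟨?_, ?_⟩, ?_⟩, ?_⟩, ?_⟩, ?_⟩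
  · exact key _ _ (by omega)
  · exact key _ _ (by omega)
  · exact key _ _ (by omega)
  · exact key _ _ (by omega)
  · refine key _ _ ?_
    have : h * (a.lower + b.lower + c.lower + d.lower) ≤ h * 12252240 := by
      simp only [Nat.mul_add]; omega
    omega
  · refine key _ _ ?_
    simp only [Nat.mul_add]
    omega

theorem FloorBracket.refute_eq_false {h w₀ w₁ w₂ w₃ : ℕ} (hsum : w₀ + w₁ + w₂ + w₃ = h)
    (hh : 0 < h)
    (hfloor : ∀ k, 2 ≤ k → k ≤ 18 → k * w₀ / h + k * w₁ / h + k * w₂ / h + k * w₃ / h + 2 = k) :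
    ∀ (n k : ℕ) (a b c d : FloorBracket), 2 ≤ k → k + n ≤ 18 → a.Valid h w₀ k → b.Valid h w₁ k →
      c.Valid h w₂ k → d.Valid h w₃ k → refute n k a b c d = false := by
  have step : ∀ k w, w ≤ h → k * w / h ≤ (k + 1) * w / h := fun k w _ =>
    Nat.div_le_div_right (Nat.mul_le_mul_right _ (by omega))
  intro n
  induction n with
  | zero =>
    intro k a b c d _ _ ha hb hc hd
    exact inconsistent_eq_false hsum hh ha hb hc hd
  | succ n ih =>
    intro k a b c d hk hkn ha hb hc hd
    have hdvd : k + 1 ∣ 12252240 := by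
      have : k ≤ 17 := by omega
      interval_cases k <;> norm_num
    have f1 := hfloor k hk (by omega)
    have f2 := hfloor (k + 1) (by omega) (by omega)
    have s0 := step k w₀ (by omega)
    have s1 := step k w₁ (by omega)
    have s2 := step k w₂ (by omega)
    have s3 := step k w₃ (by omega)
    have hI := inconsistent_eq_false hsum hh ha hb hc hd
    simp only [refute, hI, Bool.false_or]
    simp only [Bool.and_eq_false_iff]
    rcases Nat.lt_or_ge (k * w₀ / h) ((k + 1) * w₀ / h) with t0 | t0
    · exact .inl <| .inl <| .inl <| ih _ _ _ _ _ (by omega) (by omega) (ha.hit hdvd (by omega))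
        (hb.miss hh hdvd (by omega)) (hc.miss hh hdvd (by omega)) (hd.miss hh hdvd (by omega))
    rcases Nat.lt_or_ge (k * w₁ / h) ((k + 1) * w₁ / h) with t1 | t1
    · exact .inl <| .inl <| .inr <| ih _ _ _ _ _ (by omega) (by omega) (ha.miss hh hdvd (by omega))
        (hb.hit hdvd (by omega)) (hc.miss hh hdvd (by omega)) (hd.miss hh hdvd (by omega))
    rcases Nat.lt_or_ge (k * w₂ / h) ((k + 1) * w₂ / h) with t2 | t2
    · exact .inl <| .inr <| ih _ _ _ _ _ (by omega) (by omega) (ha.miss hh hdvd (by omega))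
        (hb.miss hh hdvd (by omega)) (hc.hit hdvd (by omega)) (hd.miss hh hdvd (by omega))
    · exact .inr <| ih _ _ _ _ _ (by omega) (by omega) (ha.miss hh hdvd (by omega))
        (hb.miss hh hdvd (by omega)) (hc.miss hh hdvd (by omega)) (hd.hit hdvd (by omega))

/-- Weights satisfying the floor condition up to `h - 2` have sum `h < 20`. -/
theorem sum_lt_twenty_of_floor {h : ℕ} {w : Fin 4 → ℕ} (hsum : ∑ i, w i = h)
    (hfloor : ∀ k, 2 ≤ k → k + 2 ≤ h → ∑ i, k * w i / h + 2 = k) : h < 20 := by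
  by_contra! hh
  have h2 : ∀ i, 2 * w i / h = 0 := by
    simpa [Finset.sum_eq_zero_iff] using hfloor 2 le_rfl (by omega)
  simp only [Fin.sum_univ_four] at hsum hfloor
  have hsmall : ∀ x, 2 * x / h = 0 → 2 * x < h := fun x hx =>
    (Nat.div_eq_zero_iff.1 hx).resolve_left (by omega)
  have init : ∀ x, 2 * x / h = 0 → FloorBracket.Valid h x 2 ⟨0, 0, 6126120⟩ := fun x hx => by
    have := hsmall x hx
    exact ⟨hx.symm, by simp, by simp only; omega⟩
  have := FloorBracket.refute_eq_false hsum (by omega)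
    (fun k hk hk' => hfloor k hk (by omega)) 16 2 _ _ _ _ le_rfl le_rfl
    (init _ (h2 0)) (init _ (h2 1)) (init _ (h2 2)) (init _ (h2 3))
  rw [FloorBracket.refute_eq_true] at this
  exact Bool.noConfusion this

theorem le_of_pairwise_disjoint_sorted {ι : Type*} [Fintype ι] {h : ℕ} {w : Fin 4 → ℕ}
    (hw : ∀ i, 0 < w i) (hmono : Monotone w) (hsum : ∑ i, w i = h) (hh : 4 ≤ h)
    (hfloor : ∀ k, 2 ≤ k → k + 2 ≤ h → ∑ i, k * w i / h + 2 = k)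
    (n : ι → Fin 4 → ℕ) (hn : Function.Injective n) (hlt : ∀ x i, n x i < h)
    (hdisj : ∀ x i j, i ≠ j → ∀ k,
      ¬ (h ≤ (n x i + k * w i) % h + w i ∧ h ≤ (n x j + k * w j) % h + w j)) :
    h + Fintype.card ι ≤ 35 := by
  classical
  have h20 := sum_lt_twenty_of_floor hsum hfloor
  simp only [Fin.sum_univ_four] at hsum hfloor
  have w0 := hw 0
  have w1 := hw 1
  have w2 := hw 2
  have w3 := hw 3
  have m01 : w 0 ≤ w 1 := hmono (by decide)
  have m12 : w 1 ≤ w 2 := hmono (by decide)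
  have m23 : w 2 ≤ w 3 := hmono (by decide)
  have h3 : h - w 0 - w 1 - w 2 = w 3 := by omega
  have hd : ∀ x i j, i ≠ j → wrapsDisjoint h (w i) (w j) (n x i) (n x j) = true := by
    intro x i j hij
    simp only [wrapsDisjoint, List.all_eq_true, Bool.not_eq_true', ← Bool.not_eq_true,
      Bool.and_eq_true, wraps, Nat.ble_eq]
    exact fun k _ => hdisj x i j hij k
  have hf : floorCheck h (w 0) (w 1) (w 2) (w 3) = true := by
    simp only [floorCheck, List.all_eq_true, List.mem_range, Nat.beq_eq]
    intro k hk
    have := hfloor (k + 2) (by omega) (by omega)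
    omega
  have key := smallWeightsCheck_eq_true
  rw [List.all_eq_true] at key
  have key := key h (List.mem_range.2 h20)
  simp only [Bool.or_eq_true, Nat.ble_eq, smallWeightsCheck, List.all_eq_true, List.mem_range,
    Nat.beq_eq, Bool.not_eq_true', ← Bool.not_eq_true, Bool.and_eq_true] at key
  have key := key.resolve_left (by omega) (w 0) (by omega) (w 1) (by omega) (w 2) (by omega)
  rw [h3] at key
  have key : h + (disjointOffsets h (w 0) (w 1) (w 2) (w 3)).length ≤ 35 := by
    rcases key with ((h0 | h0) | h0) | h0
    · omega
    · exact absurd ⟨⟨m01, m12⟩, m23⟩ h0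
    · exact absurd hf h0
    · exact h0
  refine le_trans (Nat.add_le_add_left ?_ _) key
  refine le_trans ?_ (List.toFinset_card_le _)
  rw [← Finset.card_univ]
  refine Finset.card_le_card_of_injOn (fun x => (n x 0, n x 1, n x 2, n x 3)) ?_ ?_
  · intro x _
    simp only [Finset.mem_coe, List.mem_toFinset, disjointOffsets, List.mem_flatMap, List.mem_map,
      List.mem_filter, List.mem_range, Bool.and_eq_true]
    exact ⟨n x 0, hlt x 0, n x 1, ⟨hlt x 1, hd x 0 1 (by decide)⟩, n x 2,
      ⟨hlt x 2, hd x 0 2 (by decide), hd x 1 2 (by decide)⟩, n x 3,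
      ⟨hlt x 3, ⟨hd x 0 3 (by decide), hd x 1 3 (by decide)⟩, hd x 2 3 (by decide)⟩, rfl⟩
  · intro x _ y _ hxy
    simp only [Prod.mk.injEq] at hxy
    apply hn
    funext i
    fin_cases i
    exacts [hxy.1, hxy.2.1, hxy.2.2.1, hxy.2.2.2]

theorem le_of_pairwise_disjoint {ι : Type*} [Fintype ι] {h : ℕ} {w : Fin 4 → ℕ}
    (hw : ∀ i, 0 < w i) (hsum : ∑ i, w i = h) (hh : 4 ≤ h)
    (hfloor : ∀ k, 2 ≤ k → k + 2 ≤ h → ∑ i, k * w i / h + 2 = k)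
    (n : ι → Fin 4 → ℕ) (hn : Function.Injective n) (hlt : ∀ x i, n x i < h)
    (hdisj : ∀ x i j, i ≠ j → ∀ k,
      ¬ (h ≤ (n x i + k * w i) % h + w i ∧ h ≤ (n x j + k * w j) % h + w j)) :
    h + Fintype.card ι ≤ 35 := by
  set σ := Tuple.sort w
  refine le_of_pairwise_disjoint_sorted (w := w ∘ σ) (fun i => hw _) (Tuple.monotone_sort w)
    ((Equiv.sum_comp σ w).trans hsum) hh (fun k hk hk' => ?_) (fun x => n x ∘ σ) ?_
    (fun x i => hlt x _) (fun x i j hij => hdisj x _ _ (σ.injective.ne hij))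
  · have := hfloor k hk hk'
    rwa [← Equiv.sum_comp σ (fun i => k * w i / h)] at this
  · intro x y hxy
    exact hn (σ.surjective.injective_comp_right hxy)

theorem Int.emod_le_self_of_nonneg {V a : ℤ} (hV : 0 < V) (ha : 0 ≤ a) : a % V ≤ a := by
  have := mul_nonneg hV.le (Int.ediv_nonneg ha hV.le)
  rw [Int.emod_def]
  omega

namespace IsResidueGroup

variable {V : ℤ} {L : AddSubgroup (Fin 4 → ℤ)} {D : Fin 4 → ℤ}

theorem V_le_thirtyFive (H : IsResidueGroup V L D) {g : Fin 4 → ℤ} (hg : g ∈ L) (hg0 : g 0 = 1)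
    (hgen : ∀ r ∈ L, ∀ i, V ∣ r i - r 0 * g i) : V ≤ 35 := by
  have hV := H.V_pos
  obtain ⟨m, h, w₀, hm, hcop, hD0, hVm⟩ : ∃ m h w₀ : ℤ, 0 < m ∧ IsCoprime w₀ h ∧
      D 0 = m * w₀ ∧ V = m * h := by
    have hpos : 0 < Int.gcd (D 0) V := Int.gcd_pos_of_ne_zero_right _ hV.ne'
    obtain ⟨a, b, hab, ha, hb⟩ := Int.exists_gcd_one hpos
    refine ⟨Int.gcd (D 0) V, b, a, by exact_mod_cast hpos, Int.isCoprime_iff_gcd_eq_one.2 hab, ?_, ?_⟩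
    · rw [mul_comm]; exact ha
    · rw [mul_comm]; exact hb
  have hmdvd : ∀ i, m ∣ D i := fun i => by
    have h1 : m ∣ D i - D 0 * g i := (Dvd.intro _ hVm.symm).trans (hgen D H.mem i)
    have h2 : m ∣ D 0 * g i := (Dvd.intro _ hD0.symm).mul_right _
    simpa using dvd_add h1 h2
  choose w hw using hmdvd
  have hw0 : w 0 = w₀ := mul_left_cancel₀ hm.ne' ((hw 0).symm.trans hD0)
  subst hw0
  have hwpos : ∀ i, 0 < w i := fun i => pos_of_mul_pos_right (hw i ▸ H.pos i) hm.le
  have hwsum : ∑ i, w i = h := by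
    refine mul_left_cancel₀ hm.ne' ?_
    rw [← hVm, ← H.sum_eq, Finset.mul_sum]
    exact Finset.sum_congr rfl fun i _ => (hw i).symm
  have hh4 : 4 ≤ h := by
    rw [← hwsum, Fin.sum_univ_four]
    have h0 := hwpos 0
    have h1 := hwpos 1
    have h2 := hwpos 2
    have h3 := hwpos 3
    omega
  have hmD : ∀ i, m ≤ D i := fun i => by
    rw [hw i]
    exact le_mul_of_one_le_right hm.le (hwpos i)
  have hdvdV : ∀ k : ℤ, V ∣ k * D 0 ↔ h ∣ k := fun k => by
    rw [hVm, hw 0, mul_left_comm, mul_dvd_mul_iff_left hm.ne']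
    exact ⟨fun hk => hcop.symm.dvd_of_dvd_mul_right hk, fun hk => hk.mul_right _⟩
  lift w to Fin 4 → ℕ using fun i => (hwpos i).le
  lift h to ℕ using (by omega)
  have hfloor : ∀ k : ℕ, 2 ≤ k → k + 2 ≤ h → ∑ i, k * w i / h + 2 = k := by
    intro k hk hk'
    have hnd : ∀ x : ℤ, 0 < x → x < h → ¬ V ∣ x * D 0 := fun x hx hx' hdvd =>
      absurd (Int.le_of_dvd hx ((hdvdV x).1 hdvd)) (by omega)
    have hsum := H.sum_emod (L.zsmul_mem H.mem k)
      (by simpa using hnd k (by omega) (by omega))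
      (by
        have := hnd (k - 1) (by omega) (by omega)
        rwa [sub_one_mul] at this)
      (by
        have := hnd (k + 1) (by omega) (by omega)
        rwa [add_one_mul] at this)
    have hq : ∀ i, ((k : ℤ) • D) i % V = k * D i - V * ((k * w i / h : ℕ) : ℤ) := fun i => by
      rw [Int.emod_def, Pi.smul_apply, smul_eq_mul, hVm, hw i, mul_left_comm,
        Int.mul_ediv_mul_of_pos _ _ hm]
      push_cast
      ring
    have htot : ∑ i, ((k : ℤ) • D) i % V = k * V - V * ((∑ i, k * w i / h : ℕ) : ℤ) := by
      simp only [hq, Finset.sum_sub_distrib, ← Finset.mul_sum, H.sum_eq]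
      push_cast
      rfl
    rw [htot] at hsum
    have : V * ((∑ i, k * w i / h : ℕ) + 2 : ℤ) = V * k := by linarith
    have := mul_left_cancel₀ hV.ne' this
    exact_mod_cast this
  obtain ⟨m', rfl⟩ : ∃ m' : ℕ, m = m' + 1 := ⟨(m - 1).toNat, by omega⟩
  set m : ℤ := m' + 1 with hmdef
  have hsum2 : ∀ r ∈ L, ¬ m ∣ r 0 → ∑ i, r i % V = 2 * V := fun r hr hr0 => by
    have hmV : m ∣ V := Dvd.intro _ hVm.symm
    have hmD0 : m ∣ D 0 := Dvd.intro _ (hw 0).symm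
    refine H.sum_emod hr (fun hd => hr0 (hmV.trans hd)) (fun hd => hr0 ?_) (fun hd => hr0 ?_)
    · simpa using dvd_add (hmV.trans hd) hmD0
    · simpa using dvd_sub (hmV.trans hd) hmD0
  have hhpos : (0 : ℤ) < h := by omega
  have hmod : ∀ a : ℤ, m * ((a / m) % h) + a % m = a % V := fun a => by
    have h1 := Int.emod_add_mul_ediv a m
    have h2 := Int.emod_add_mul_ediv (a / m) h
    have h3 := Int.emod_nonneg a hm.ne'
    have h4 := Int.emod_lt_of_pos a hm
    have h5 := Int.emod_nonneg (a / m) hhpos.ne'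
    have h6 := Int.emod_lt_of_pos (a / m) hhpos
    refine ((Int.ediv_emod_unique (q := a / m / h) hV).2 ⟨?_, by positivity, ?_⟩).2.symm
    · rw [hVm]
      linear_combination h1 + m * h2
    · rw [hVm]
      nlinarith
  have hdisj : ∀ r ∈ L, ¬ m ∣ r 0 → ∀ i j, i ≠ j →
      ¬ ((h : ℤ) ≤ (r i / m) % h + w i ∧ (h : ℤ) ≤ (r j / m) % h + w j) := by
    rintro r hr hr0 i j hij ⟨hi, hj⟩
    have hwrap : ∀ l, (h : ℤ) ≤ (r l / m) % h + w l → (r l + D l) % V ≤ r l % V + D l - V := by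
      intro l hl
      have h1 : V ≤ r l % V + D l := by
        rw [← hmod, hw l, hVm]
        have := Int.emod_nonneg (r l) hm.ne'
        nlinarith
      rw [← Int.emod_add_emod, ← Int.sub_emod_right]
      exact Int.emod_le_self_of_nonneg hV (by omega)
    have hle : ∀ l, (r l + D l) % V ≤ r l % V + D l := fun l => by
      rw [← Int.emod_add_emod]
      exact Int.emod_le_self_of_nonneg hV (add_nonneg (Int.emod_nonneg _ hV.ne') (H.pos l).le)
    have h1 := hsum2 r hr hr0
    have h2 := hsum2 (r + D) (L.add_mem hr H.mem) fun hd =>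
      hr0 ((Int.dvd_iff_dvd_of_dvd_add hd).2 (Dvd.intro _ (hw 0).symm))
    have h3 : ∑ l, (r + D) l % V ≤
        ∑ l, (r l % V + D l - (if l = i then V else 0) - (if l = j then V else 0)) := by
      refine Finset.sum_le_sum fun l _ => ?_
      rcases eq_or_ne l i with rfl | hli
      · simpa [hij] using hwrap l hi
      rcases eq_or_ne l j with rfl | hlj
      · simpa [hli] using hwrap l hj
      · simpa [hli, hlj] using hle l
    simp only [Finset.sum_sub_distrib, Finset.sum_add_distrib, Finset.sum_ite_eq',
      Finset.mem_univ, if_true, h1, h2, H.sum_eq] at h3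
    omega
  let r : Fin m' × Fin h → Fin 4 → ℤ := fun x => ((x.1 : ℤ) + 1) • g + (x.2 : ℤ) • D
  have hr : ∀ x, r x ∈ L := fun x => L.add_mem (L.zsmul_mem hg _) (L.zsmul_mem H.mem _)
  have hr0 : ∀ x, r x 0 = x.1 + 1 + x.2 * D 0 := fun x => by
    simp [r, hg0]
  have hrm : ∀ x (k : ℤ), ¬ m ∣ (r x + k • D) 0 := fun x k hd => by
    have h1 : (r x + k • D) 0 = (x.1 + 1) + m * (w 0 * (x.2 + k)) := by
      rw [Pi.add_apply, Pi.smul_apply, hr0, hw 0, smul_eq_mul]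
      ring
    rw [h1] at hd
    have h2 := (Int.dvd_add_left (Dvd.intro _ rfl)).1 hd
    have h3 := Int.le_of_dvd (by omega) h2
    have := x.1.2
    omega
  let n : Fin m' × Fin h → Fin 4 → ℕ := fun x i => ((r x i / m) % h).toNat
  have hncast : ∀ x i, (n x i : ℤ) = (r x i / m) % h := fun x i =>
    Int.toNat_of_nonneg (Int.emod_nonneg _ hhpos.ne')
  have hlt : ∀ x i, n x i < h := fun x i => by
    have := Int.emod_lt_of_pos (r x i / m) hhpos
    rw [← hncast] at this
    exact_mod_cast this
  have hinj : Function.Injective n := by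
    intro x y hxy
    let s : Fin 4 → ℤ := (fun i => r x i % V) - fun i => r y i % V
    have hs : s ∈ L := L.sub_mem (H.emod_mem (hr x)) (H.emod_mem (hr y))
    have hs0 : s = 0 := by
      refine H.eq_zero_of_abs_lt hmD (by rw [hVm, mul_comm]; gcongr) hs fun i => ?_
      have h1 : s i = r x i % m - r y i % m := by
        have : (n x i : ℤ) = n y i := by rw [hxy]
        rw [hncast, hncast] at this
        simp only [s, Pi.sub_apply, ← hmod, this]
        ring
      have h2 := Int.emod_nonneg (r x i) hm.ne'
      have h3 := Int.emod_lt_of_pos (r x i) hm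
      have h4 := Int.emod_nonneg (r y i) hm.ne'
      have h5 := Int.emod_lt_of_pos (r y i) hm
      rw [h1, abs_lt]
      constructor <;> linarith
    have hVd : V ∣ r x 0 - r y 0 :=
      Int.ModEq.dvd (sub_eq_zero.1 (congrFun hs0 0)).symm
    rw [hr0, hr0] at hVd
    have hmd : m ∣ (x.1 - y.1 : ℤ) := by
      have h1 : m ∣ ((x.1 : ℤ) + 1 + x.2 * D 0) - (y.1 + 1 + y.2 * D 0) :=
        (Dvd.intro _ hVm.symm).trans hVd
      have h2 : ((x.1 : ℤ) + 1 + x.2 * D 0) - (y.1 + 1 + y.2 * D 0) =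
          (x.1 - y.1) + m * (w 0 * (x.2 - y.2)) := by
        rw [hw 0]
        ring
      rw [h2] at h1
      exact (Int.dvd_add_left (Dvd.intro _ rfl)).1 h1
    have hx1 := x.1.2
    have hy1 := y.1.2
    have h1 : (x.1 - y.1 : ℤ) = 0 :=
      Int.eq_zero_of_abs_lt_dvd hmd (by rw [abs_lt]; constructor <;> omega)
    have h2 : (h : ℤ) ∣ (x.2 - y.2 : ℤ) := by
      rw [← hdvdV]
      convert hVd using 1
      linear_combination -h1
    have hx2 := x.2.2
    have hy2 := y.2.2
    have h3 : (x.2 - y.2 : ℤ) = 0 :=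
      Int.eq_zero_of_abs_lt_dvd h2 (by rw [abs_lt]; constructor <;> omega)
    exact Prod.ext (Fin.ext (by omega)) (Fin.ext (by omega))
  have hcard := le_of_pairwise_disjoint (fun i => Int.natCast_pos.1 (hwpos i))
    (Nat.cast_injective (R := ℤ) (by rw [Nat.cast_sum]; exact hwsum)) (by exact_mod_cast hh4)
    hfloor n hinj hlt (by
      rintro x i j hij k ⟨hi, hj⟩
      have hshift : ∀ l, (((r x + (k : ℤ) • D) l / m) % h : ℤ) = ((n x l + k * w l) % h : ℕ) := by
        intro l
        push_cast
        rw [hncast, Int.emod_add_emod, Pi.add_apply, Pi.smul_apply, smul_eq_mul, hw l,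
          mul_left_comm, Int.add_mul_ediv_left _ _ hm.ne']
      refine hdisj _ (L.add_mem (hr x) (L.zsmul_mem H.mem k)) (hrm x k) i j hij ⟨?_, ?_⟩
      · rw [hshift]; exact_mod_cast hi
      · rw [hshift]; exact_mod_cast hj)
  rw [Fintype.card_prod, Fintype.card_fin, Fintype.card_fin] at hcard
  have : V = ((h + m' * h : ℕ) : ℤ) := by
    rw [hVm, hmdef]
    push_cast
    ring
  rw [this]
  exact_mod_cast hcard

theorem eq_twenty_or_lt (H : IsResidueGroup V L D) {g : Fin 4 → ℤ} (hg : g ∈ L) (hg0 : g 0 = 1)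
    (hgen : ∀ r ∈ L, ∀ i, V ∣ r i - r 0 * g i) :
    V < 20 ∨ V = 20 ∧ ∃ σ : Equiv.Perm (Fin 4), ∀ i, V ∣ g i - ![1, 9, 13, 17] (σ i) := by
  rw [or_iff_not_imp_left, not_lt]
  intro h20
  have h35 := H.V_le_thirtyFive hg hg0 hgen
  have hV := H.V_pos
  obtain ⟨N, rfl⟩ := Int.eq_ofNat_of_zero_le hV.le
  choose a ha using fun i => Int.eq_ofNat_of_zero_le (Int.emod_nonneg (g i) hV.ne')
  have ha_lt : ∀ i, a i < N := fun i => by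
    have := Int.emod_lt_of_pos (g i) hV
    rw [ha] at this
    exact_mod_cast this
  have ha_dvd : ∀ i, (N : ℤ) ∣ g i - a i := fun i => by
    rw [← ha]; exact Int.dvd_self_sub_emod
  have ha0 : a 0 = 1 := by
    have := ha 0
    rw [hg0, Int.emod_eq_of_lt (by omega) (by omega)] at this
    exact_mod_cast this.symm
  have hcop : ∀ i, Nat.gcd (a i) N = 1 := by
    intro i
    have hpos : 0 < Nat.gcd (a i) N := Nat.gcd_pos_of_pos_right _ (by omega)
    obtain ⟨e, he⟩ := Nat.gcd_dvd_left (a i) N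
    obtain ⟨f, hf⟩ := Nat.gcd_dvd_right (a i) N
    have h1 : (N : ℤ) ∣ ((f : ℤ) • g) i := by
      have h2 : (N : ℤ) ∣ f * a i := by
        refine ⟨e, ?_⟩
        have : f * a i = N * e := by
          conv_lhs => rw [he]
          conv_rhs => rw [hf]
          ring
        exact_mod_cast this
      have h3 := dvd_add ((ha_dvd i).mul_left (f : ℤ)) h2
      simpa [mul_sub] using h3
    have h2 := H.dvd_of_dvd (L.zsmul_mem hg f) h1 0
    simp only [Pi.smul_apply, hg0, smul_eq_mul, mul_one] at h2
    have h3 : N ∣ f := by exact_mod_cast h2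
    have hfpos : 0 < f := Nat.pos_of_ne_zero fun h => by
      rw [h, mul_zero] at hf
      omega
    have h4 := Nat.le_of_dvd hfpos h3
    by_contra hne
    have : 2 * f ≤ N := by
      conv_rhs => rw [hf]
      exact Nat.mul_le_mul_right _ (by omega)
    omega
  have hmul : ∀ (k : ℕ) i, ((k : ℤ) • g) i % N = (k * a i % N : ℕ) := fun k i => by
    push_cast
    rw [← ha, Pi.smul_apply, smul_eq_mul]
    exact ((Int.mod_modEq (g i) N).mul_left k).symm
  have hres : ∀ k : ℕ, ∑ i, ((k : ℤ) • g) i % N = residueSum N (a 1) (a 2) (a 3) k := fun k => by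
    simp only [hmul, Fin.sum_univ_four, residueSum, ha0, mul_one]
    push_cast
    rfl
  have hD0 : D 0 < N := by
    have := H.sum_eq
    rw [Fin.sum_univ_four] at this
    have h1 := H.pos 1
    have h2 := H.pos 2
    have h3 := H.pos 3
    omega
  obtain ⟨d, hd⟩ := Int.eq_ofNat_of_zero_le (H.pos 0).le
  have hdN : d < N := by omega
  have hiff : ∀ k < N, residueSum N (a 1) (a 2) (a 3) k = N ↔ k = d := by
    intro k hk
    constructor
    · intro hsum
      have h1 := H.emod_eq (L.zsmul_mem hg k) (by rw [hres, hsum]) 0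
      rw [hmul, ha0, mul_one, Nat.mod_eq_of_lt hk, hd] at h1
      exact_mod_cast h1
    · rintro rfl
      have h1 : ∑ i, ((k : ℤ) • g) i % N = N := by
        rw [← H.sum_eq]
        refine Finset.sum_congr rfl fun i _ => ?_
        have h2 : D i % N = D i := by
          refine Int.emod_eq_of_lt (H.pos i).le ?_
          rw [← H.sum_eq]
          obtain ⟨j, hj⟩ := exists_ne i
          exact Finset.single_lt_sum hj (Finset.mem_univ _) (Finset.mem_univ _) (H.pos j)
            fun l _ _ => (H.pos l).le
        have h3 := hgen D H.mem i
        rw [hd] at h3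
        rw [H.sum_eq, ← h2]
        exact (Int.emod_emod_of_dvd _ dvd_rfl).symm.trans
          (by rw [Int.emod_emod]; exact ((Int.modEq_iff_dvd.2 h3)))
      rw [hres] at h1
      exact_mod_cast h1
  have hcount : ((List.range N).countP fun k =>
      Nat.beq (residueSum N (a 1) (a 2) (a 3) k) N) = 1 := by
    rw [← List.count_eq_one_of_mem (List.nodup_range) (List.mem_range.2 hdN), List.count]
    refine List.countP_congr fun k hk => ?_
    rw [Nat.beq_eq, beq_iff_eq]
    exact hiff k (List.mem_range.1 hk)
  have hc : a 3 = (2 * N - 1 - a 1 - a 2) % N := by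
    have h1 : (N : ℤ) ∣ 1 + a 1 + a 2 + a 3 := by
      have h2 := H.dvd_sum g hg
      rw [Fin.sum_univ_four, hg0] at h2
      have h3 := dvd_sub (dvd_sub (dvd_sub h2 (ha_dvd 1)) (ha_dvd 2)) (ha_dvd 3)
      have h4 : (1 + a 1 + a 2 + a 3 : ℤ) = 1 + g 1 + g 2 + g 3 - (g 1 - a 1) - (g 2 - a 2) -
          (g 3 - a 3) := by ring
      rw [h4]
      exact h3
    have h2 : N ∣ 1 + a 1 + a 2 + a 3 := by exact_mod_cast h1
    have l1 := ha_lt 1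
    have l2 := ha_lt 2
    have l3 := ha_lt 3
    obtain ⟨q, hq⟩ := h2
    have hq1 : 0 < q := Nat.pos_of_ne_zero fun h => by
      rw [h] at hq
      omega
    have hq3 : q < 4 := by
      by_contra! h
      nlinarith
    have h3 : 2 * N - 1 - a 1 - a 2 = a 3 ∨ 2 * N - 1 - a 1 - a 2 = a 3 + N ∨
        2 * N - 1 - a 1 - a 2 + N = a 3 := by
      interval_cases q <;> omega
    rcases h3 with h3 | h3 | h3
    · rw [h3, Nat.mod_eq_of_lt l3]
    · rw [h3, Nat.add_mod_right, Nat.mod_eq_of_lt l3]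
    · omega
  have key := generatorCheck_eq_true
  rw [List.all_eq_true] at key
  have key := key N (List.mem_range.2 (by omega))
  simp only [Bool.or_eq_true, Nat.ble_eq, List.all_eq_true, List.mem_range] at key
  have key := key.resolve_left (by omega) (a 1) (ha_lt 1) (a 2) (ha_lt 2)
  rw [← hc] at key
  simp only [generatorCheck, hcop, hcount, Nat.beq_refl, Bool.and_self, Bool.not_true,
    Bool.false_or, Bool.and_eq_true, Nat.beq_eq, List.contains_cons, List.contains_nil,
    Bool.or_false, Bool.or_eq_true, beq_iff_eq, Prod.mk.injEq] at key
  obtain ⟨hN, hperm⟩ := key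
  refine ⟨by exact_mod_cast hN, ?_⟩
  obtain ⟨σ, hσ⟩ : ∃ σ : Equiv.Perm (Fin 4), ∀ i, a i = ![1, 9, 13, 17] (σ i) := by
    have hall : ∀ f : Fin 4 → Fin 4, Function.Bijective f → (∀ i, a i = ![1, 9, 13, 17] (f i)) →
        ∃ σ : Equiv.Perm (Fin 4), ∀ i, a i = ![1, 9, 13, 17] (σ i) := fun f hf hfa =>
      ⟨Equiv.ofBijective f hf, hfa⟩
    rcases hperm with h | h | h | h | h | h
    · refine hall ![0, 1, 2, 3] (by decide) fun i => ?_
      fin_cases i <;> simp [ha0, h]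
    · refine hall ![0, 1, 3, 2] (by decide) fun i => ?_
      fin_cases i <;> simp [ha0, h]
    · refine hall ![0, 2, 1, 3] (by decide) fun i => ?_
      fin_cases i <;> simp [ha0, h]
    · refine hall ![0, 2, 3, 1] (by decide) fun i => ?_
      fin_cases i <;> simp [ha0, h]
    · refine hall ![0, 3, 1, 2] (by decide) fun i => ?_
      fin_cases i <;> simp [ha0, h]
    · refine hall ![0, 3, 2, 1] (by decide) fun i => ?_
      fin_cases i <;> simp [ha0, h]
  refine ⟨σ, fun i => ?_⟩
  have h1 := ha_dvd i
  rw [hσ i] at h1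
  convert h1 using 2
  generalize σ i = j
  fin_cases j <;> rfl

end IsResidueGroup

section Volume

open MeasureTheory

theorem volume_nonneg_sum_le (n : ℕ) : ∀ {t : ℝ}, 0 ≤ t →
    volume {x : Fin n → ℝ | (∀ i, 0 ≤ x i) ∧ ∑ i, x i ≤ t} =
      ENNReal.ofReal (t ^ n / n.factorial) := by
  induction n with
  | zero =>
    intro t ht
    have : {x : Fin 0 → ℝ | (∀ i, 0 ≤ x i) ∧ ∑ i, x i ≤ t} = Set.univ := by
      ext x
      simp [ht]
    rw [this, volume_pi, Measure.pi_of_empty]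
    simp
  | succ n ih =>
    intro t ht
    let T : Set (ℝ × (Fin n → ℝ)) :=
      {p | 0 ≤ p.1 ∧ (∀ i, 0 ≤ p.2 i) ∧ ∑ i, p.2 i ≤ t - p.1}
    have hT : MeasurableSet T := by
      refine IsClosed.measurableSet ?_
      simp only [T, Set.ofPred_and, Set.ofPred_forall]
      refine (isClosed_le (by fun_prop) (by fun_prop)).inter
        ((isClosed_iInter fun i => isClosed_le (by fun_prop) (by fun_prop)).inter
          (isClosed_le (by fun_prop) (by fun_prop)))
    have hpre : {x : Fin (n + 1) → ℝ | (∀ i, 0 ≤ x i) ∧ ∑ i, x i ≤ t} =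
        MeasurableEquiv.piFinSuccAbove (fun _ => ℝ) 0 ⁻¹' T := by
      ext x
      simp only [Set.mem_ofPred_eq, Set.mem_preimage, T, Fin.forall_fin_succ, Fin.sum_univ_succ,
        MeasurableEquiv.piFinSuccAbove_apply, Fin.insertNthEquiv_zero, Fin.consEquiv_symm_apply,
        Fin.tail]
      rw [and_assoc, le_sub_iff_add_le']
    rw [hpre, (volume_preserving_piFinSuccAbove (fun _ => ℝ) 0).measure_preimage
      hT.nullMeasurableSet, Measure.volume_eq_prod, Measure.prod_apply hT]
    have hslice : ∀ x : ℝ, volume (Prod.mk x ⁻¹' T) =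
        (Set.Icc 0 t).indicator (fun x => ENNReal.ofReal ((t - x) ^ n / n.factorial)) x := by
      intro x
      by_cases hx : x ∈ Set.Icc 0 t
      · rw [Set.indicator_of_mem hx, ← ih (sub_nonneg.2 hx.2)]
        congr 1
        ext y
        simp [T, hx.1]
      · rw [Set.indicator_of_notMem hx]
        convert measure_empty (μ := (volume : Measure (Fin n → ℝ)))
        ext y
        simp only [T, Set.mem_preimage, Set.mem_ofPred_eq, Set.mem_empty_iff_false, iff_false]
        rintro ⟨h1, h2, h3⟩
        exact hx ⟨h1, by linarith [Finset.sum_nonneg fun i (_ : i ∈ Finset.univ) => h2 i]⟩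
    simp only [hslice]
    rw [lintegral_indicator measurableSet_Icc, ← ofReal_integral_eq_lintegral_ofReal]
    · congr 1
      rw [integral_Icc_eq_integral_Ioc, ← intervalIntegral.integral_of_le ht,
        intervalIntegral.integral_div,
        intervalIntegral.integral_comp_sub_left (fun x => x ^ n) t, integral_pow]
      simp [Nat.factorial_succ]
      field_simp
    · exact (Continuous.continuousOn (by fun_prop)).integrableOn_Icc
    · refine (ae_restrict_iff' measurableSet_Icc).2 (Filter.Eventually.of_forall fun x hx => ?_)
      have := sub_nonneg.2 hx.2
      simp only [Pi.zero_apply]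
      positivity

theorem volume_image_mulVec_add {n : ℕ} (A : Matrix (Fin n) (Fin n) ℝ) (w : Fin n → ℝ)
    (s : Set (Fin n → ℝ)) :
    volume ((fun x => A.mulVec x + w) '' s) = ENNReal.ofReal |A.det| * volume s := by
  have : (fun x => A.mulVec x + w) '' s = (fun x => x + w) '' (Matrix.toLin' A '' s) := by
    rw [Set.image_image]
    rfl
  rw [this, Set.image_add_right, measure_preimage_add_right, Measure.addHaar_image_linearMap,
    LinearMap.det_toLin']

end Volume

theorem mem_hullOf_iff {d : ℕ} {v : Fin (d + 1) → Fin d → ℤ} {x : Fin d → ℝ} :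
    x ∈ hullOf v ↔ ∃ c : Fin (d + 1) → ℝ, (∀ i, 0 ≤ c i) ∧ ∑ i, c i = 1 ∧
      ∑ i, c i • toR (v i) = x := by
  constructor
  · rw [hullOf, convexHull_range_eq_exists_affineCombination]
    rintro ⟨s, c, hc, hsum, rfl⟩
    refine ⟨fun i => if i ∈ s then c i else 0, fun i => ?_, by simpa using hsum, ?_⟩
    · dsimp only
      split_ifs with hi
      exacts [hc i hi, le_rfl]
    · rw [s.affineCombination_eq_linear_combination _ _ hsum]
      simp
  · rintro ⟨c, hc, hsum, hx⟩
    exact mem_convexHull_of_exists_fintype c _ hc hsum (fun i => Set.mem_range_self i) hx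

/-- The rows are the points `v i` in homogeneous coordinates. -/
def homogenization {d : ℕ} (v : Fin (d + 1) → Fin d → ℤ) : Matrix (Fin (d + 1)) (Fin (d + 1)) ℤ :=
  Matrix.of fun i => Fin.cons 1 (v i)

theorem six_mul_volume_hullOf (v : Fin 4 → Fin 3 → ℤ) :
    6 * (MeasureTheory.volume (hullOf v)).toReal = ((|(homogenization v).det| : ℤ) : ℝ) := by
  let W : Matrix (Fin 3) (Fin 3) ℝ := Matrix.of fun j i => toR (v i.succ) j - toR (v 0) j
  have himage : hullOf v = (fun x => W.mulVec x + toR (v 0)) ''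
      {x : Fin 3 → ℝ | (∀ i, 0 ≤ x i) ∧ ∑ i, x i ≤ 1} := by
    ext x
    rw [mem_hullOf_iff]
    constructor
    · rintro ⟨c, hc, hsum, rfl⟩
      have hsum : ∑ i : Fin 4, c i = 1 := hsum
      refine ⟨fun i => c i.succ, ⟨fun i => hc _, ?_⟩, ?_⟩
      · rw [Fin.sum_univ_succ] at hsum
        linarith [hc 0]
      · funext j
        change _ = (∑ i : Fin 4, c i • toR (v i)) j
        rw [Fin.sum_univ_four] at hsum
        simp only [W, Matrix.mulVec, dotProduct, Matrix.of_apply, Pi.add_apply, Finset.sum_apply,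
          Pi.smul_apply, smul_eq_mul, Fin.sum_univ_four, Fin.sum_univ_three, Fin.succ_zero_eq_one,
          Fin.succ_one_eq_two, show Fin.succ (2 : Fin 3) = 3 from rfl]
        linear_combination (-toR (v 0) j) * hsum
    · rintro ⟨y, ⟨hy, hsum⟩, rfl⟩
      refine ⟨Fin.cons (1 - ∑ i, y i) y, ?_, ?_, ?_⟩
      · intro i
        refine Fin.cases ?_ (fun i => ?_) i
        · simpa using hsum
        · simpa using hy i
      · rw [Fin.sum_univ_succ]
        simp
      · funext j
        simp [W, Matrix.mulVec, dotProduct, Fin.sum_univ_succ]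
        ring
  have hdet : W.det = ((homogenization v).det : ℝ) := by
    rw [Matrix.det_succ_row_zero (homogenization v)]
    have h2 (i : Fin 4) : (Fin.cons 1 (v i) : Fin 4 → ℤ) 2 = v i 1 := rfl
    have h3 (i : Fin 4) : (Fin.cons 1 (v i) : Fin 4 → ℤ) 3 = v i 2 := rfl
    simp [W, Matrix.det_fin_three, homogenization, Fin.sum_univ_succ, toR, Fin.succAbove, h2, h3]
    ring
  rw [himage, volume_image_mulVec_add, volume_nonneg_sum_le 3 zero_le_one, hdet,
    ENNReal.toReal_mul, ENNReal.toReal_ofReal (abs_nonneg _), ENNReal.toReal_ofReal (by positivity)]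
  push_cast
  norm_num [Nat.factorial]
  ring

section Homogenization

variable {d : ℕ} {v : Fin (d + 1) → Fin d → ℤ}

theorem vecMul_homogenization_zero (r : Fin (d + 1) → ℤ) :
    Matrix.vecMul r (homogenization v) 0 = ∑ i, r i := by
  simp [Matrix.vecMul, dotProduct, homogenization]

theorem vecMul_homogenization_succ (r : Fin (d + 1) → ℤ) (j : Fin d) :
    Matrix.vecMul r (homogenization v) j.succ = ∑ i, r i * v i j := by
  simp [Matrix.vecMul, dotProduct, homogenization]

theorem det_homogenization_ne_zero (hv : AffineIndependent ℝ fun i => toR (v i)) :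
    (homogenization v).det ≠ 0 := by
  intro h
  obtain ⟨a, ha, hav⟩ := Matrix.exists_vecMul_eq_zero_iff.2 h
  refine ha (funext fun i => ?_)
  have hsum : ∑ i, a i = 0 := by
    rw [← vecMul_homogenization_zero (v := v), hav, Pi.zero_apply]
  have := affineIndependent_iff.1 hv Finset.univ (fun i => (a i : ℝ)) (mod_cast hsum) ?_ i
    (Finset.mem_univ i)
  · exact_mod_cast this
  · funext j
    have : ∑ i, a i * v i j = 0 := by
      rw [← vecMul_homogenization_succ, hav, Pi.zero_apply]
    simp only [Finset.sum_apply, Pi.smul_apply, smul_eq_mul, toR, Pi.zero_apply]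
    exact_mod_cast this

theorem exists_pos_of_mem_interior_hullOf (hv : AffineIndependent ℝ fun i => toR (v i))
    {x : Fin d → ℝ} (hx : x ∈ interior (hullOf v)) :
    ∃ c : Fin (d + 1) → ℝ, (∀ i, 0 < c i) ∧ ∑ i, c i = 1 ∧ ∑ i, c i • toR (v i) = x := by
  let b : AffineBasis (Fin (d + 1)) ℝ (Fin d → ℝ) :=
    ⟨fun i => toR (v i), hv, hv.affineSpan_eq_top_iff_card_eq_finrank_add_one.2 (by simp)⟩
  have hb : x ∈ interior (convexHull ℝ (Set.range b)) := hx
  rw [b.interior_convexHull] at hb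
  exact ⟨fun i => b.coord i x, hb, b.sum_coord_apply_eq_one x, b.linear_combination_coord_eq_self x⟩

/-- The integer vectors whose combination of the rows of `homogenization v` vanishes modulo the
determinant. -/
def residueGroup (v : Fin (d + 1) → Fin d → ℤ) : AddSubgroup (Fin (d + 1) → ℤ) where
  carrier := {r | ∀ j, (homogenization v).det ∣ Matrix.vecMul r (homogenization v) j}
  zero_mem' := by simp
  add_mem' ha hb j := by
    rw [Matrix.add_vecMul]
    exact dvd_add (ha j) (hb j)
  neg_mem' ha j := by
    rw [Matrix.neg_vecMul]
    exact (dvd_neg).2 (ha j)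

theorem adjugate_mem_residueGroup (i : Fin (d + 1)) :
    (homogenization v).adjugate i ∈ residueGroup v := by
  intro j
  have := congrFun (congrFun (homogenization v).adjugate_mul i) j
  rw [Matrix.mul_apply_eq_vecMul] at this
  rw [this, Matrix.smul_apply, smul_eq_mul]
  exact dvd_mul_right _ _

end Homogenization

/-- The distinguished vector is the determinant times the barycentric coordinates of the origin. -/
theorem isResidueGroup_residueGroup {v : Fin 4 → Fin 3 → ℤ} (hv : IsOnePointSimplex v) :
    IsResidueGroup |(homogenization v).det| (residueGroup v)
      ((homogenization v).det.sign • (homogenization v).adjugate 0) := by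
  obtain ⟨hind, hint, hpts⟩ := hv
  have hdet := det_homogenization_ne_zero hind
  set M := homogenization v with hM
  have hD : Matrix.vecMul (M.det.sign • M.adjugate 0) M = |M.det| • Pi.single 0 1 := by
    have := congrFun M.adjugate_mul 0
    rw [Matrix.mul_apply_eq_vecMul] at this
    rw [Matrix.smul_vecMul, this]
    funext j
    change M.det.sign * (M.det • (1 : Matrix (Fin 4) (Fin 4) ℤ)) 0 j = _
    rw [Matrix.smul_apply, smul_eq_mul, ← mul_assoc, Int.sign_mul_self_eq_abs]
    simp [Matrix.one_apply, Pi.single_apply, eq_comm]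
  have hinj : ∀ r s : Fin 4 → ℤ, Matrix.vecMul r M = Matrix.vecMul s M → r = s := by
    intro r s h
    exact sub_eq_zero.1 (Matrix.eq_zero_of_vecMul_eq_zero hdet
      (by rw [Matrix.sub_vecMul, h, sub_self]))
  have hVpos : 0 < |M.det| := abs_pos.2 hdet
  set V := |M.det| with hV
  set D := M.det.sign • M.adjugate 0 with hDdef
  have hsumD : ∑ i, D i = V := by
    rw [← vecMul_homogenization_zero (v := v), ← hM, hD]
    simp
  refine ⟨fun s j => ?_, fun r hr => ?_, ?_, fun i => ?_, hsumD, fun r hr h0 hlt hsum => ?_⟩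
  · rw [Matrix.smul_vecMul, Pi.smul_apply, smul_eq_mul]
    exact ((dvd_abs _ _).2 dvd_rfl).mul_right _
  · rw [← vecMul_homogenization_zero (v := v), abs_dvd]
    exact hr 0
  · exact (residueGroup v).zsmul_mem (adjugate_mem_residueGroup 0) _
  · obtain ⟨c, hc, hc1, hc0⟩ := exists_pos_of_mem_interior_hullOf hind hint
    have hcD := affineIndependent_iff.1 hind Finset.univ (fun i => (D i : ℝ) - V * c i) ?_ ?_ i
      (Finset.mem_univ i)
    · have : (0 : ℝ) < D i := by
        rw [sub_eq_zero.1 hcD]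
        have := hc i
        have : (0 : ℝ) < V := mod_cast hVpos
        positivity
      exact_mod_cast this
    · rw [Finset.sum_sub_distrib, ← Finset.mul_sum, hc1, mul_one, sub_eq_zero]
      exact_mod_cast hsumD
    · funext j
      have h1 : ∑ i, D i * v i j = 0 := by
        rw [← vecMul_homogenization_succ, ← hM, hD]
        simp
      have h2 : ∑ i, (D i : ℝ) * v i j = 0 := mod_cast h1
      have h3 := congrFun hc0 j
      simp only [Finset.sum_apply, Pi.smul_apply, smul_eq_mul, Pi.zero_apply, toR] at h3 ⊢
      simp only [sub_mul, Finset.sum_sub_distrib, h2, mul_assoc, ← Finset.mul_sum, h3]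
      simp
  · have hx : ∀ j : Fin 3, ∃ y : ℤ, Matrix.vecMul r M j.succ = V * y := fun j => by
      rw [hV]
      exact (abs_dvd _ _).2 (hr j.succ)
    choose x hx using hx
    have hmem : toR x ∈ hullOf v := by
      refine mem_hullOf_iff.2 ⟨fun i => r i / V, fun i => ?_, ?_, ?_⟩
      · have := h0 i
        positivity
      · rw [← Finset.sum_div, div_eq_one_iff_eq (by positivity)]
        exact_mod_cast hsum
      · funext j
        have h1 : ∑ i, (r i : ℝ) * v i j = V * x j := by
          have := hx j
          rw [hM, vecMul_homogenization_succ] at this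
          exact_mod_cast this
        simp only [Finset.sum_apply, Pi.smul_apply, smul_eq_mul, toR, div_mul_eq_mul_div,
          ← Finset.sum_div, h1]
        field_simp
    obtain rfl | ⟨k, rfl⟩ := hpts x hmem
    · refine hinj _ _ ?_
      rw [hD]
      funext j
      refine Fin.cases ?_ (fun j => ?_) j
      · rw [hM, vecMul_homogenization_zero, hsum]
        simp
      · rw [hx]
        simp
    · exfalso
      have : r = Pi.single k V := by
        refine hinj _ _ ?_
        funext j
        refine Fin.cases ?_ (fun j => ?_) j
        · rw [hM, vecMul_homogenization_zero, vecMul_homogenization_zero, hsum]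
          simp
        · rw [hx, hM, vecMul_homogenization_succ]
          simp [Pi.single_apply]
      have h := hlt k
      simp [this] at h

theorem exists_homogenization_generator {v : Fin 4 → Fin 3 → ℤ} (hv : IsOnePointSimplex v) :
    ∃ g ∈ residueGroup v, g 0 = 1 ∧
      ∀ r ∈ residueGroup v, ∀ i, |(homogenization v).det| ∣ r i - r 0 * g i := by
  refine (isResidueGroup_residueGroup hv).exists_generator _ adjugate_mem_residueGroup ?_
  rw [Matrix.det_adjugate]
  exact pow_dvd_pow_of_dvd ((dvd_abs _ _).2 dvd_rfl) _

theorem hullOf_comp_equiv {d : ℕ} (v : Fin (d + 1) → Fin d → ℤ) (σ : Equiv.Perm (Fin (d + 1))) :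
    hullOf (v ∘ σ) = hullOf v := by
  rw [hullOf, hullOf, ← σ.surjective.range_comp fun i => toR (v i)]
  rfl

theorem hullOf_eq_image {d : ℕ} {v v' : Fin (d + 1) → Fin d → ℤ} {A : Matrix (Fin d) (Fin d) ℝ}
    {w : Fin d → ℝ} (h : ∀ i, toR (v' i) = A.mulVec (toR (v i)) + w) :
    hullOf v' = (fun x => A.mulVec x + w) '' hullOf v := by
  have key (c : Fin (d + 1) → ℝ) (hc : ∑ i, c i = 1) :
      A.mulVec (∑ i, c i • toR (v i)) + w = ∑ i, c i • toR (v' i) := by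
    simp [h, Matrix.mulVec_sum, Matrix.mulVec_smul, Finset.sum_add_distrib, ← Finset.sum_smul, hc]
  ext x
  simp only [mem_hullOf_iff, Set.mem_image]
  constructor
  · rintro ⟨c, hc, hc1, rfl⟩
    exact ⟨_, ⟨c, hc, hc1, rfl⟩, key c hc1⟩
  · rintro ⟨_, ⟨c, hc, hc1, rfl⟩, rfl⟩
    exact ⟨c, hc, hc1, (key c hc1).symm⟩

theorem unimodEquiv_of_dvd_adjugate_mul {d : ℕ} {v v' : Fin (d + 1) → Fin d → ℤ}
    (hv : (homogenization v).det ≠ 0)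
    (habs : |(homogenization v').det| = |(homogenization v).det|)
    (hdvd : ∀ i j, (homogenization v).det ∣
      ((homogenization v).adjugate * homogenization v') i j) :
    UnimodEquiv (hullOf v) (hullOf v') := by
  choose N hN using hdvd
  have hmul : homogenization v * Matrix.of N = homogenization v' := by
    have h : (homogenization v).adjugate * homogenization v' =
        (homogenization v).det • Matrix.of N := by
      ext i j
      rw [hN]
      rfl
    have h2 : (homogenization v).det • (homogenization v * Matrix.of N) =
        (homogenization v).det • homogenization v' := by
      rw [← Matrix.mul_smul, ← h, ← Matrix.mul_assoc, Matrix.mul_adjugate, Matrix.smul_mul,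
        Matrix.one_mul]
    exact smul_right_injective _ hv h2
  have hcol : (fun k => N k 0) = Pi.single 0 1 := by
    refine sub_eq_zero.1 (Matrix.eq_zero_of_mulVec_eq_zero hv ?_)
    rw [Matrix.mulVec_sub, sub_eq_zero]
    funext i
    have := congrFun (congrFun hmul i) 0
    rw [Matrix.mul_apply] at this
    simpa [Matrix.mulVec, dotProduct, homogenization, Pi.single_apply] using this
  have hdetN : (Matrix.of N).det = (Matrix.of fun i j : Fin d => N i.succ j.succ).det := by
    rw [Matrix.det_succ_column_zero, Finset.sum_eq_single 0]
    · have : N 0 0 = 1 := by simpa using congrFun hcol 0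
      simp [this]
      rfl
    · intro k _ hk
      have : N k 0 = 0 := by simpa [hk] using congrFun hcol k
      simp [this]
    · simp
  refine ⟨(Matrix.of fun i j : Fin d => N i.succ j.succ).transpose, fun j => N 0 j.succ, ?_,
    hullOf_eq_image fun i => ?_⟩
  · rw [Matrix.det_transpose, ← hdetN]
    have h := congrArg Matrix.det hmul
    rw [Matrix.det_mul] at h
    rw [← h, abs_mul] at habs
    rw [Int.isUnit_iff_abs_eq]
    exact mul_left_cancel₀ (abs_ne_zero.2 hv) (habs.trans (mul_one _).symm)
  · funext j
    have := congrFun (congrFun hmul i) j.succ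
    rw [Matrix.mul_apply, Fin.sum_univ_succ] at this
    simp only [homogenization, Matrix.of_apply, Fin.cons_zero, Fin.cons_succ, one_mul] at this
    simp only [toR, Matrix.mulVec, dotProduct, Pi.add_apply, Matrix.map_apply,
      Matrix.transpose_apply, Matrix.of_apply, ← this]
    push_cast
    rw [add_comm]
    simp only [mul_comm]

theorem UnimodEquiv.volume_eq {d : ℕ} {Q Q' : Set (Fin d → ℝ)} (h : UnimodEquiv Q Q') :
    MeasureTheory.volume Q' = MeasureTheory.volume Q := by
  obtain ⟨A, w, hA, rfl⟩ := h
  have hdet : (A.map fun n : ℤ => (n : ℝ)).det = (A.det : ℝ) := (Int.cast_det A).symm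
  rw [volume_image_mulVec_add, hdet, ← Int.cast_abs, Int.isUnit_iff_abs_eq.1 hA]
  simp

/-- A one-point simplex of normalized volume `20`; the origin has barycentric coordinates
`1 / 20, 9 / 20, 13 / 20, 17 / 20` modulo `1`. -/
def extremalVertices : Fin 4 → Fin 3 → ℤ :=
  ![![-2, -3, -5], ![1, 0, 0], ![1, 2, 5], ![0, 1, 0]]

theorem hullOf_extremalVertices : hullOf extremalVertices =
    convexHull ℝ {toR ![(1 : ℤ), 0, 0], toR ![(0 : ℤ), 1, 0], toR ![(1 : ℤ), 2, 5],
      toR ![(-2 : ℤ), -3, -5]} := by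
  rw [hullOf]
  congr 1
  ext x
  simp only [Set.mem_range, Fin.exists_fin_succ, extremalVertices, Set.mem_insert_iff,
    Set.mem_singleton_iff, eq_comm (a := x)]
  simp
  tauto

theorem abs_det_homogenization_extremalVertices :
    |(homogenization extremalVertices).det| = 20 := by
  decide

theorem dvd_sum_extremalVertices (j : Fin 4) :
    20 ∣ ∑ i, ![1, 9, 13, 17] i * homogenization extremalVertices i j := by
  revert j
  decide

theorem unimodEquiv_extremalVertices {v : Fin 4 → Fin 3 → ℤ}
    (hdet : |(homogenization v).det| = 20) {g : Fin 4 → ℤ}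
    (hgen : ∀ r ∈ residueGroup v, ∀ i, 20 ∣ r i - r 0 * g i) {σ : Equiv.Perm (Fin 4)}
    (hσ : ∀ i, 20 ∣ g i - ![1, 9, 13, 17] (σ i)) :
    UnimodEquiv (hullOf v) (hullOf extremalVertices) := by
  rw [← hullOf_comp_equiv extremalVertices σ]
  have hperm : homogenization (extremalVertices ∘ σ) =
    (homogenization extremalVertices).submatrix σ id := rfl
  refine unimodEquiv_of_dvd_adjugate_mul (by rw [← abs_pos, hdet]; norm_num) ?_ fun i j => ?_
  · rw [hdet, hperm, Matrix.det_permute, abs_mul, abs_det_homogenization_extremalVertices]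
    obtain h | h := Int.units_eq_one_or (Equiv.Perm.sign σ) <;> simp [h]
  · rw [← abs_dvd, hdet, hperm, Matrix.mul_apply]
    set r := (homogenization v).adjugate i with hr
    have h1 : 20 ∣ r 0 * ∑ l, ![1, 9, 13, 17] (σ l) * homogenization extremalVertices (σ l) j := by
      rw [Equiv.sum_comp σ fun l => ![1, 9, 13, 17] l * homogenization extremalVertices l j]
      exact (dvd_sum_extremalVertices j).mul_left _
    rw [Finset.mul_sum] at h1
    refine (dvd_sub_left h1).1 ?_
    rw [← Finset.sum_sub_distrib]
    refine Finset.dvd_sum fun l _ => ?_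
    obtain ⟨a, ha⟩ := hgen r (adjugate_mem_residueGroup i) l
    obtain ⟨b, hb⟩ := hσ l
    refine ⟨(a + r 0 * b) * homogenization extremalVertices (σ l) j, ?_⟩
    simp only [Matrix.submatrix_apply, id]
    linear_combination homogenization extremalVertices (σ l) j * (ha + r 0 * hb)

theorem onePoint_simplex_volume_dim3 (v : Fin 4 → Fin 3 → ℤ) (hv : IsOnePointSimplex v) :
    6 * (MeasureTheory.volume (hullOf v)).toReal ≤ 20 ∧
      (6 * (MeasureTheory.volume (hullOf v)).toReal = 20 ↔
        UnimodEquiv (hullOf v)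
          (convexHull ℝ
            ({toR ![(1 : ℤ), 0, 0], toR ![(0 : ℤ), 1, 0], toR ![(1 : ℤ), 2, 5],
              toR ![(-2 : ℤ), -3, -5]} : Set (Fin 3 → ℝ)))) := by
  obtain ⟨g, hg, hg0, hgen⟩ := exists_homogenization_generator hv
  have hclass := (isResidueGroup_residueGroup hv).eq_twenty_or_lt hg hg0 hgen
  rw [← hullOf_extremalVertices]
  refine ⟨?_, fun h => ?_, fun h => ?_⟩
  · rw [six_mul_volume_hullOf]
    have : |(homogenization v).det| ≤ 20 := hclass.elim le_of_lt fun h => h.1.le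
    exact_mod_cast this
  · rw [six_mul_volume_hullOf] at h
    have hdet : |(homogenization v).det| = 20 := by exact_mod_cast h
    rw [hdet] at hclass hgen
    obtain h | ⟨-, σ, hσ⟩ := hclass
    · exact absurd h (lt_irrefl _)
    · exact unimodEquiv_extremalVertices hdet hgen hσ
  · rw [← h.volume_eq, six_mul_volume_hullOf, abs_det_homogenization_extremalVertices]
    norm_num
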